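/- Let G = (V, ℰ) be a finite connected undirected graph without loops, 𝒜 its set of arcs (both orientations of each edge), and 𝒮 the set of nonempty proper subsets of V. A strictly positive family (P_a)_{a∈𝒜} satisfies P^c = P^{rc} for every cycle c (equivalently, satisfies detailed balance) if, and only if, there exist positive parameters s(e) > 0 for e ∈ ℰ and t_B > 0 for B ∈ 𝒮 such that for every arc (v→w) ∈ 𝒜: P_{v→w} = s({v,w}) · ∏_{B∈𝒮 : v∈B, w∉B} t_B · ∏_{B∈𝒮 : w∈B, v∉B} t_B^{−1}. -/

import Mathlib

/-- The transition count of the trajectory `ω = ω_0 ω_1 ⋯ ω_n`. -/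
def transCount {V : Type*} [DecidableEq V] {n : ℕ} (ω : Fin (n + 1) → V) (v w : V) : ℕ :=
  (Finset.univ.filter (fun k : Fin n => ω k.castSucc = v ∧ ω k.succ = w)).card

/-- `ω` is a cycle (an elementary closed trajectory) of the graph `G`. -/
def IsCycle {V : Type*} (G : SimpleGraph V) {n : ℕ} (ω : Fin (n + 1) → V) : Prop :=
  1 ≤ n ∧ (∀ k : Fin n, G.Adj (ω k.castSucc) (ω k.succ)) ∧ ω (Fin.last n) = ω 0 ∧
    ∀ j j' : Fin n, ω j.castSucc = ω j'.castSucc → j = j'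

lemma trans_prod {V : Type*} [Fintype V] [DecidableEq V] (P : V → V → ℝ) {n : ℕ}
    (ω : Fin (n + 1) → V) :
    ∏ v, ∏ w, P v w ^ transCount ω v w = ∏ k : Fin n, P (ω k.castSucc) (ω k.succ) := by
  have h1 : ∀ v w, P v w ^ transCount ω v w
      = ∏ k : Fin n, if ω k.castSucc = v ∧ ω k.succ = w then P v w else 1 := by
    intro v w
    rw [← Finset.prod_filter, Finset.prod_const]
    rfl
  simp_rw [h1]
  have h2 : ∀ v, ∏ w, ∏ k : Fin n, (if ω k.castSucc = v ∧ ω k.succ = w then P v w else 1)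
      = ∏ k : Fin n, ∏ w, (if ω k.castSucc = v ∧ ω k.succ = w then P v w else 1) :=
    fun v => Finset.prod_comm
  simp_rw [h2]
  rw [Finset.prod_comm]
  refine Finset.prod_congr rfl fun k _ => ?_
  rw [Finset.prod_eq_single (ω k.castSucc), Finset.prod_eq_single (ω k.succ)]
  · simp
  · intro b _ hb
    simp [hb.symm]
  · simp
  · intro b _ hb
    refine Finset.prod_eq_one fun w _ => ?_
    simp [hb.symm]
  · simp

lemma trans_prod_rev {V : Type*} [Fintype V] [DecidableEq V] (P : V → V → ℝ) {n : ℕ}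
    (ω : Fin (n + 1) → V) :
    ∏ v, ∏ w, P v w ^ transCount (fun j : Fin (n + 1) => ω j.rev) v w
      = ∏ k : Fin n, P (ω k.succ) (ω k.castSucc) := by
  rw [trans_prod]
  refine Fintype.prod_equiv Fin.revPerm _ _ fun k => ?_
  simp [Fin.rev_castSucc, Fin.rev_succ]

/-- product of ratios along a walk -/
noncomputable def wprod {V : Type*} {G : SimpleGraph V} (P : V → V → ℝ) :
    ∀ {u v : V}, G.Walk u v → ℝ
  | _, _, .nil => 1
  | _, _, .cons (u := u) (v := w) _ p => (P u w / P w u) * wprod P p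

lemma wprod_append {V : Type*} {G : SimpleGraph V} (P : V → V → ℝ) {u v w : V}
    (p : G.Walk u v) (q : G.Walk v w) : wprod P (p.append q) = wprod P p * wprod P q := by
  induction p with
  | nil => simp [wprod]
  | cons h p ih => simp [wprod, ih, mul_assoc]

lemma wprod_fin {V : Type*} {G : SimpleGraph V} (P : V → V → ℝ) {u v : V}
    (p : G.Walk u v) : wprod P p = ∏ k ∈ Finset.range p.length,
      (P (p.getVert k) (p.getVert (k + 1)) / P (p.getVert (k + 1)) (p.getVert k)) := by
  induction p with
  | nil => simp [wprod]
  | cons h p ih =>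
    rw [wprod, ih]
    rw [SimpleGraph.Walk.length_cons, Finset.prod_range_succ', mul_comm]
    simp

def CycCond {V : Type*} [Fintype V] [DecidableEq V] (G : SimpleGraph V) (P : V → V → ℝ) : Prop :=
  ∀ (n : ℕ) (ω : Fin (n + 1) → V), IsCycle G ω →
          ∏ v, ∏ w, P v w ^ transCount ω v w
            = ∏ v, ∏ w, P v w ^ transCount (fun j : Fin (n + 1) => ω j.rev) v w

lemma wprod_cycle {V : Type*} [Fintype V] [DecidableEq V] {G : SimpleGraph V} {P : V → V → ℝ}
    (hP : ∀ v w, G.Adj v w → 0 < P v w) (hC : CycCond G P) {u w : V} (h : G.Adj u w)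
    (q : G.Walk w u) (hq : q.IsPath) : wprod P (SimpleGraph.Walk.cons h q) = 1 := by
  rw [wprod_fin, SimpleGraph.Walk.length_cons, Finset.prod_range]
  have hadj : ∀ k : Fin (q.length + 1),
      G.Adj ((SimpleGraph.Walk.cons h q).getVert k) ((SimpleGraph.Walk.cons h q).getVert (k+1)) :=
    fun k => SimpleGraph.Walk.adj_getVert_succ _ k.2
  have hinj := hq.getVert_injOn
  have := hC (q.length + 1) (fun k => (SimpleGraph.Walk.cons h q).getVert k) (by
    refine ⟨by omega, fun k => ?_, ?_, ?_⟩
    · simpa using hadj k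
    · simp
    · intro j j' hj
      have aux : ∀ i : Fin (q.length + 1), (SimpleGraph.Walk.cons h q).getVert i
          = q.getVert (if (i : ℕ) = 0 then q.length else i - 1) := by
        intro i
        refine Fin.cases ?_ (fun i => ?_) i
        · simp
        · simp
      simp only [Fin.val_castSucc] at hj
      rw [aux, aux] at hj
      have h3 := hinj (by simp only [Set.mem_ofPred_eq]; split_ifs <;> omega)
        (by simp only [Set.mem_ofPred_eq]; split_ifs <;> omega) hj
      ext
      split_ifs at h3 <;> omega)
  rw [trans_prod, trans_prod_rev P (fun k => (SimpleGraph.Walk.cons h q).getVert k)] at this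
  simp only [Fin.val_castSucc, Fin.val_succ] at this
  rw [Finset.prod_div_distrib, div_eq_one_iff_eq]
  · exact this
  · exact Finset.prod_ne_zero_iff.2 fun k _ => (hP _ _ (hadj k).symm).ne'

lemma wprod_bypass {V : Type*} [Fintype V] [DecidableEq V] {G : SimpleGraph V} {P : V → V → ℝ}
    (hP : ∀ v w, G.Adj v w → 0 < P v w) (hC : CycCond G P) {u v : V}
    (p : G.Walk u v) : wprod P p.bypass = wprod P p := by
  induction p with
  | nil => simp [SimpleGraph.Walk.bypass]
  | @cons u w v h p ih =>
    rw [SimpleGraph.Walk.bypass]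
    split_ifs with hs
    · have h1 := wprod_cycle hP hC h (p.bypass.takeUntil u hs)
        (p.bypass_isPath.takeUntil hs)
      have h2 : wprod P p.bypass
          = wprod P (p.bypass.takeUntil u hs) * wprod P (p.bypass.dropUntil u hs) := by
        rw [← wprod_append, SimpleGraph.Walk.take_spec]
      rw [wprod] at h1 ⊢
      rw [← ih, h2, ← mul_assoc, h1, one_mul]
    · rw [wprod, wprod, ih]

lemma wprod_closed {V : Type*} [Fintype V] [DecidableEq V] {G : SimpleGraph V} {P : V → V → ℝ}
    (hP : ∀ v w, G.Adj v w → 0 < P v w) (hC : CycCond G P) {u : V}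
    (p : G.Walk u u) : wprod P p = 1 := by
  rw [← wprod_bypass hP hC, SimpleGraph.Walk.isPath_iff_eq_nil.1 p.bypass_isPath, wprod]

lemma wprod_pos {V : Type*} {G : SimpleGraph V} {P : V → V → ℝ}
    (hP : ∀ v w, G.Adj v w → 0 < P v w) {u v : V}
    (p : G.Walk u v) : 0 < wprod P p := by
  induction p with
  | nil => simp [wprod]
  | cons h p ih => exact mul_pos (div_pos (hP _ _ h) (hP _ _ h.symm)) ih

def DBal {V : Type*} (G : SimpleGraph V) (P : V → V → ℝ) : Prop :=
  ∃ κ : V → ℝ, (∀ v, 0 < κ v) ∧ ∀ v w, G.Adj v w → κ v * P v w = κ w * P w v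

lemma cyc_to_db {V : Type*} [Fintype V] [DecidableEq V] {G : SimpleGraph V} {P : V → V → ℝ}
    (hG : G.Connected) (hP : ∀ v w, G.Adj v w → 0 < P v w) (hC : CycCond G P) : DBal G P := by
  obtain ⟨x⟩ := hG.nonempty
  have hw : ∀ v, Nonempty (G.Walk x v) := fun v => hG.preconnected x v
  refine ⟨fun v => wprod P (hw v).some, fun v => wprod_pos hP _, fun v w h => ?_⟩
  obtain ⟨r⟩ := hG.preconnected w x
  have h1 := wprod_closed hP hC ((hw w).some.append r)
  have h2 := wprod_closed hP hC ((hw v).some.append (SimpleGraph.Walk.cons h r))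
  rw [wprod_append] at h1 h2
  rw [wprod] at h2
  have h3 := (wprod_pos hP r).ne'
  have h4 := (hP _ _ h.symm).ne'
  beta_reduce
  have h5 := h2.trans h1.symm
  rw [← mul_assoc] at h5
  have h6 := mul_right_cancel₀ h3 h5
  rw [← h6]
  field_simp

lemma db_to_cyc {V : Type*} [Fintype V] [DecidableEq V] {G : SimpleGraph V} {P : V → V → ℝ}
    (hD : DBal G P) : CycCond G P := by
  obtain ⟨κ, hκ, hb⟩ := hD
  rintro n ω ⟨-, hadj, hcl, -⟩
  rw [trans_prod, trans_prod_rev]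
  have h1 : ∏ k : Fin n, (κ (ω k.castSucc) * P (ω k.castSucc) (ω k.succ))
      = ∏ k : Fin n, (κ (ω k.succ) * P (ω k.succ) (ω k.castSucc)) :=
    Finset.prod_congr rfl fun k _ => hb _ _ (hadj k)
  rw [Finset.prod_mul_distrib, Finset.prod_mul_distrib] at h1
  have h2 : ∏ k : Fin n, κ (ω k.castSucc) = ∏ k : Fin n, κ (ω k.succ) := by
    have e1 := Fin.prod_univ_succ (fun k => κ (ω k))
    rw [Fin.prod_univ_castSucc, hcl, mul_comm] at e1
    exact mul_left_cancel₀ (hκ _).ne' e1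
  rw [h2] at h1
  exact mul_left_cancel₀ (Finset.prod_ne_zero_iff.2 fun k _ => (hκ _).ne') h1

def Param {V : Type*} [Fintype V] [DecidableEq V] (G : SimpleGraph V) (P : V → V → ℝ) : Prop :=
  ∃ (s : V → V → ℝ) (t : Finset V → ℝ),
            (∀ v w, s v w = s w v) ∧ (∀ v w, G.Adj v w → 0 < s v w) ∧ (∀ B, 0 < t B) ∧
            ∀ v w, G.Adj v w → P v w = s v w *
              (∏ B ∈ Finset.univ.filter
                (fun B : Finset V => B.Nonempty ∧ B ≠ Finset.univ ∧ v ∈ B ∧ w ∉ B), t B) *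
              (∏ B ∈ Finset.univ.filter
                (fun B : Finset V => B.Nonempty ∧ B ≠ Finset.univ ∧ w ∈ B ∧ v ∉ B), t B)⁻¹

lemma param_to_db {V : Type*} [Fintype V] [DecidableEq V] {G : SimpleGraph V} {P : V → V → ℝ}
    (hD : Param G P) : DBal G P := by
  obtain ⟨s, t, hs, -, ht, h⟩ := hD
  let A : V → ℝ := fun v => ∏ B ∈ Finset.univ.filter
    (fun B : Finset V => B.Nonempty ∧ B ≠ Finset.univ ∧ v ∈ B), t B
  let M : V → V → ℝ := fun v w => ∏ B ∈ Finset.univ.filter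
    (fun B : Finset V => B.Nonempty ∧ B ≠ Finset.univ ∧ v ∈ B ∧ w ∉ B), t B
  let C : V → V → ℝ := fun v w => ∏ B ∈ Finset.univ.filter
    (fun B : Finset V => B.Nonempty ∧ B ≠ Finset.univ ∧ v ∈ B ∧ w ∈ B), t B
  have hA : ∀ v, 0 < A v := fun v => Finset.prod_pos fun B _ => ht B
  have hM : ∀ v w, 0 < M v w := fun v w => Finset.prod_pos fun B _ => ht B
  have hCC : ∀ v w, C v w = C w v := fun v w => by
    refine Finset.prod_congr ?_ fun _ _ => rfl
    ext B; simp; tauto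
  have hAM : ∀ v w, A v = C v w * M v w := fun v w => by
    simp only [A, C, M]
    rw [← Finset.prod_filter_mul_prod_filter_not _ (fun B => w ∈ B), Finset.filter_filter,
      Finset.filter_filter]
    simp only [and_assoc]
  refine ⟨fun v => (A v ^ 2)⁻¹, fun v => by have := hA v; positivity, fun v w hvw => ?_⟩
  have e1 : P v w = s v w * M v w * (M w v)⁻¹ := h v w hvw
  have e2 : P w v = s v w * M w v * (M v w)⁻¹ := by rw [hs]; exact h w v hvw.symm
  beta_reduce
  have hc : C v w ≠ 0 := (Finset.prod_pos fun B _ => ht B).ne'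
  have m1 := (hM v w).ne'
  have m2 := (hM w v).ne'
  rw [e1, e2, hAM v w, hAM w v, hCC w v]
  field_simp

lemma db_to_param {V : Type*} [Fintype V] [DecidableEq V] {G : SimpleGraph V} {P : V → V → ℝ}
    (hP : ∀ v w, G.Adj v w → 0 < P v w) (hD : DBal G P) : Param G P := by
  obtain ⟨κ, hκ, hb⟩ := hD
  let t : Finset V → ℝ := fun B => if B.card = 1 then ∏ x ∈ B, (√(κ x))⁻¹ else 1
  have hsq : ∀ v, 0 < √(κ v) := fun v => Real.sqrt_pos.2 (hκ v)
  have ht : ∀ v w, v ≠ w → ∏ B ∈ Finset.univ.filter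
      (fun B : Finset V => B.Nonempty ∧ B ≠ Finset.univ ∧ v ∈ B ∧ w ∉ B), t B = (√(κ v))⁻¹ := by
    intro v w hvw
    rw [Finset.prod_eq_single {v}]
    · simp [t]
    · intro B hB hne
      simp only [t]
      rw [if_neg]
      intro hc
      obtain ⟨a, rfl⟩ := Finset.card_eq_one.1 hc
      simp only [Finset.mem_filter, Finset.mem_singleton] at hB
      exact hne (by rw [hB.2.2.2.1])
    · intro hn
      exfalso
      apply hn
      simp only [Finset.mem_filter, Finset.mem_univ, true_and, Finset.mem_singleton]
      refine ⟨by simp, fun h => ?_, hvw.symm⟩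
      have : w ∈ ({v} : Finset V) := h ▸ Finset.mem_univ w
      exact hvw (Finset.mem_singleton.1 this).symm
  refine ⟨fun v w => √(P v w * P w v), t, fun v w => by simp only [mul_comm], fun v w h =>
    Real.sqrt_pos.2 (mul_pos (hP _ _ h) (hP _ _ h.symm)), fun B => ?_, fun v w h => ?_⟩
  · simp only [t]
    split_ifs
    · exact Finset.prod_pos fun x _ => inv_pos.2 (hsq x)
    · exact one_pos
  · rw [ht v w h.ne, ht w v h.ne.symm, inv_inv]
    have h1 := hsq v
    have e : √(P v w * P w v) * √(κ w) = P v w * √(κ v) := by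
      have p1 := hP _ _ h
      have p2 := hP _ _ h.symm
      rw [← Real.sqrt_mul (by positivity)]
      rw [show P v w * P w v * κ w = P v w ^ 2 * κ v by linear_combination (-P v w) * hb v w h]
      rw [Real.sqrt_mul (by positivity), Real.sqrt_sq p1.le]
    rw [mul_right_comm, e]
    field_simp

/-- A strictly positive family `(P_a)` on the arcs of a finite connected
graph satisfies `P^c = P^{rc}` for every cycle `c` (equivalently, detailed balance) iff it
admits the monomial parameterization
`P_{v→w} = s({v,w}) ∏_{B : v∈B, w∉B} t_B ∏_{B : w∈B, v∉B} t_B⁻¹`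
with `s` symmetric positive and `t_B > 0` over nonempty proper subsets `B ⊊ V`. -/
theorem stmt14 {V : Type*} [Fintype V] [DecidableEq V]
    (G : SimpleGraph V) (hG : G.Connected)
    (P : V → V → ℝ) (hP : ∀ v w, G.Adj v w → 0 < P v w) :
    ((∀ (n : ℕ) (ω : Fin (n + 1) → V), IsCycle G ω →
          ∏ v, ∏ w, P v w ^ transCount ω v w
            = ∏ v, ∏ w, P v w ^ transCount (fun j : Fin (n + 1) => ω j.rev) v w)
        ↔ ∃ (s : V → V → ℝ) (t : Finset V → ℝ),
            (∀ v w, s v w = s w v) ∧ (∀ v w, G.Adj v w → 0 < s v w) ∧ (∀ B, 0 < t B) ∧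
            ∀ v w, G.Adj v w → P v w = s v w *
              (∏ B ∈ Finset.univ.filter
                (fun B : Finset V => B.Nonempty ∧ B ≠ Finset.univ ∧ v ∈ B ∧ w ∉ B), t B) *
              (∏ B ∈ Finset.univ.filter
                (fun B : Finset V => B.Nonempty ∧ B ≠ Finset.univ ∧ w ∈ B ∧ v ∉ B), t B)⁻¹)
    ∧ ((∃ κ : V → ℝ, (∀ v, 0 < κ v) ∧ ∀ v w, G.Adj v w → κ v * P v w = κ w * P w v)
        ↔ ∃ (s : V → V → ℝ) (t : Finset V → ℝ),
            (∀ v w, s v w = s w v) ∧ (∀ v w, G.Adj v w → 0 < s v w) ∧ (∀ B, 0 < t B) ∧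
            ∀ v w, G.Adj v w → P v w = s v w *
              (∏ B ∈ Finset.univ.filter
                (fun B : Finset V => B.Nonempty ∧ B ≠ Finset.univ ∧ v ∈ B ∧ w ∉ B), t B) *
              (∏ B ∈ Finset.univ.filter
                (fun B : Finset V => B.Nonempty ∧ B ≠ Finset.univ ∧ w ∈ B ∧ v ∉ B), t B)⁻¹) := by
  exact ⟨⟨fun h => db_to_param hP (cyc_to_db hG hP h), fun h => db_to_cyc (param_to_db h)⟩,
    ⟨fun h => db_to_param hP h, fun h => param_to_db h⟩⟩
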